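/- arXiv:1709.06735 — 3 statements merged into one kernel-verified Lean document; each statement's English description precedes it below -/
import Mathlib

section
/- For every integer n ≥ 1, the maximal value of the extended 2-colored partition function p_{-2}(λ) = ∏_j p_{-2}(λ_j) over all (ordinary) partitions λ = (λ_1, λ_2, …) of n equals 5^{n/2} if n is even and 2 · 5^{(n−1)/2} if n is odd; in particular, for every partition λ of n one has ∏_j p_{-2}(λ_j) ≤ this value, and the value is attained by some partition of n. -/
/-- A `k`-colored partition of `n`: a multiset of pairs `(m, c)` where `m` is a positive
part size and `c ∈ {0, …, k-1}` is a color (color `j` of the paper corresponds to `j - 1`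
here), such that the part sizes sum to `n`. -/
structure ColoredPartition (k n : ℕ) where
  parts : Multiset (ℕ × ℕ)
  parts_pos : ∀ p ∈ parts, 0 < p.1
  parts_color : ∀ p ∈ parts, p.2 < k
  parts_sum : (parts.map Prod.fst).sum = n

/-- `p_{-k}(n)`, the number of `k`-colored partitions of `n`. -/
noncomputable def coloredPartitions (k n : ℕ) : ℕ := Nat.card (ColoredPartition k n)

/-- `p_{-k}(n | avoiding s)`: the number of `k`-colored partitions of `n` containing
no part belonging to the set `s` of (size, color) pairs. -/
noncomputable def coloredPartitionsAvoiding (k n : ℕ) (s : Set (ℕ × ℕ)) : ℕ :=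
  Nat.card {p : ColoredPartition k n // ∀ x ∈ s, x ∉ p.parts}

/-- Merge all parts of size `1` having one common color (color `0` if it occurs, color `1`
otherwise) into a single part of that color, whose size is further increased by `j`. -/
def mergeOnes (j : ℕ) (q : Multiset (ℕ × ℕ)) : Multiset (ℕ × ℕ) :=
  let c := if (1, 0) ∈ q then 0 else 1
  (q.count (1, c) + j, c) ::ₘ q.filter (· ≠ (1, c))

/-- Five operations on multisets of colored parts; together they produce every two-colored
partition of `n + 2` from the two-colored partitions of `n`. -/
def raiseByTwo (q : Multiset (ℕ × ℕ)) : Fin 5 → Multiset (ℕ × ℕ)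
  | 0 => {(1, 0), (1, 0)} + q
  | 1 => {(1, 1), (1, 1)} + q
  | 2 => if q.count (1, 0) + q.count (1, 1) = 0 then {(1, 0), (1, 1)} + q else mergeOnes 2 q
  | 3 => if q.count (1, 0) + q.count (1, 1) ≤ 1 then {(2, 0)} + q
      else (1, 0) ::ₘ mergeOnes 1 q
  | 4 => if q.count (1, 0) + q.count (1, 1) ≤ 1 then {(2, 1)} + q
      else (1, 1) ::ₘ mergeOnes 1 q

theorem mergeOnes_replicate_add {j k c : ℕ} {r : Multiset (ℕ × ℕ)} (hk : 0 < k) (hc : c < 2)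
    (h0 : (1, 0) ∉ r) (h1 : (1, 1) ∉ r) :
    mergeOnes j (Multiset.replicate k (1, c) + r) = (k + j, c) ::ₘ r := by
  have hr : ∀ a ∈ r, a ≠ (1, c) := by
    rintro a ha rfl
    interval_cases c <;> contradiction
  have hif : (if (1, 0) ∈ Multiset.replicate k (1, c) + r then 0 else 1) = c := by
    interval_cases c <;> simp [Multiset.mem_replicate, h0, hk.ne']
  have hcount : r.count (1, c) = 0 := Multiset.count_eq_zero.2 fun h => hr _ h rfl
  have hfilter : (Multiset.replicate k ((1 : ℕ), c)).filter (· ≠ (1, c)) = 0 :=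
    Multiset.filter_eq_nil.2 fun a ha => by simp [Multiset.eq_of_mem_replicate ha]
  simp only [mergeOnes, hif, Multiset.count_add, Multiset.count_replicate_self, hcount,
    Multiset.filter_add, hfilter, Multiset.filter_eq_self.2 hr, add_zero, zero_add]

namespace ColoredPartition

theorem parts_injective (k n : ℕ) :
    Function.Injective (parts : ColoredPartition k n → Multiset (ℕ × ℕ)) := by
  rintro ⟨s, _, _, _⟩ ⟨t, _, _, _⟩ h
  cases h
  rfl

/-- Replacing a submultiset of the parts of a colored partition. -/
theorem exists_parts_eq_add {k m n : ℕ} (p : ColoredPartition k m) {a b r : Multiset (ℕ × ℕ)}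
    (h : p.parts = a + r) (hpos : ∀ x ∈ b, 0 < x.1) (hcol : ∀ x ∈ b, x.2 < k)
    (hsum : (b.map Prod.fst).sum + m = (a.map Prod.fst).sum + n) :
    ∃ q : ColoredPartition k n, q.parts = b + r := by
  have hm := p.parts_sum
  rw [h, Multiset.map_add, Multiset.sum_add] at hm
  refine ⟨⟨b + r, fun x hx => ?_, fun x hx => ?_, ?_⟩, rfl⟩
  · rcases Multiset.mem_add.1 hx with hx | hx
    · exact hpos x hx
    · exact p.parts_pos x (h ▸ Multiset.mem_add.2 (.inr hx))
  · rcases Multiset.mem_add.1 hx with hx | hx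
    · exact hcol x hx
    · exact p.parts_color x (h ▸ Multiset.mem_add.2 (.inr hx))
  · rw [Multiset.map_add, Multiset.sum_add]
    omega

theorem exists_raiseByTwo_eq {n : ℕ} (p : ColoredPartition 2 (n + 2)) :
    ∃ (q : ColoredPartition 2 n) (t : Fin 5), raiseByTwo q.parts t = p.parts := by
  by_cases h0 : 2 ≤ p.parts.count (1, 0)
  · obtain ⟨r, hr⟩ := Multiset.le_iff_exists_add.1 (Multiset.le_count_iff_replicate_le.1 h0)
    obtain ⟨q, hq⟩ := p.exists_parts_eq_add (n := n) (b := 0) hr (by simp) (by simp)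
      (by simp; omega)
    exact ⟨q, 0, by rw [hr, hq, zero_add]; rfl⟩
  by_cases h1 : 2 ≤ p.parts.count (1, 1)
  · obtain ⟨r, hr⟩ := Multiset.le_iff_exists_add.1 (Multiset.le_count_iff_replicate_le.1 h1)
    obtain ⟨q, hq⟩ := p.exists_parts_eq_add (n := n) (b := 0) hr (by simp) (by simp)
      (by simp; omega)
    exact ⟨q, 1, by rw [hr, hq, zero_add]; rfl⟩
  by_cases h01 : p.parts.count (1, 0) + p.parts.count (1, 1) = 2
  · have m0 : (1, 0) ∈ p.parts := Multiset.count_pos.1 (by omega)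
    have m1 : (1, 1) ∈ p.parts := Multiset.count_pos.1 (by omega)
    obtain ⟨s, hs⟩ := Multiset.exists_cons_of_mem m0
    have m1' : (1, 1) ∈ s := by simpa [hs] using m1
    obtain ⟨r, rfl⟩ := Multiset.exists_cons_of_mem m1'
    have hr : p.parts = {(1, 0), (1, 1)} + r := by simp [hs]
    obtain ⟨q, hq⟩ := p.exists_parts_eq_add (n := n) (b := 0) hr (by simp) (by simp)
      (by simp; omega)
    have hz : r.count (1, 0) + r.count (1, 1) = 0 := by
      simp [hs] at h01
      omega
    exact ⟨q, 2, by rw [hr, hq, zero_add, raiseByTwo, if_pos hz]⟩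
  have hle : p.parts.count (1, 0) + p.parts.count (1, 1) ≤ 1 := by omega
  by_cases h2 : ∃ d < 2, (2, d) ∈ p.parts
  · obtain ⟨d, hd, m2⟩ := h2
    obtain ⟨r, hs⟩ := Multiset.exists_cons_of_mem m2
    have hr : p.parts = {(2, d)} + r := by simp [hs]
    obtain ⟨q, hq⟩ := p.exists_parts_eq_add (n := n) (b := 0) hr (by simp) (by simp)
      (by simp; omega)
    have hz : r.count (1, 0) + r.count (1, 1) ≤ 1 := by
      simpa [hs, Multiset.count_cons] using hle
    interval_cases d
    · exact ⟨q, 3, by rw [hr, hq, zero_add, raiseByTwo, if_pos hz]⟩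
    · exact ⟨q, 4, by rw [hr, hq, zero_add, raiseByTwo, if_pos hz]⟩
  have hlarge : ∀ x ∈ p.parts, x.1 ≠ 1 → 3 ≤ x.1 := by
    rintro ⟨m, c⟩ hx hx1
    have hpos := p.parts_pos _ hx
    have hcol := p.parts_color _ hx
    have hne : m ≠ 2 := by
      rintro rfl
      exact h2 ⟨c, hcol, hx⟩
    simp only at *
    omega
  by_cases hones : ∃ d < 2, (1, d) ∈ p.parts
  · obtain ⟨d, hd, m1⟩ := hones
    obtain ⟨s, hs⟩ := Multiset.exists_cons_of_mem m1
    have hs01 : s.count (1, 0) = 0 ∧ s.count (1, 1) = 0 := by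
      rw [hs, Multiset.count_cons, Multiset.count_cons] at hle
      interval_cases d <;> simp at hle <;> omega
    obtain ⟨x, hx⟩ : ∃ x, x ∈ s := by
      refine Multiset.exists_mem_of_ne_zero ?_
      rintro rfl
      have := p.parts_sum
      simp [hs] at this
    obtain ⟨r, rfl⟩ := Multiset.exists_cons_of_mem hx
    obtain ⟨m, c⟩ := x
    have hxp : (m, c) ∈ p.parts := by simp [hs]
    have hc : c < 2 := p.parts_color _ hxp
    simp only [Multiset.count_eq_zero] at hs01
    have hm : 3 ≤ m := by
      refine hlarge _ hxp ?_
      rintro rfl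
      interval_cases c <;> simp at hs01
    have hr0 : (1, 0) ∉ r := fun h => hs01.1 (Multiset.mem_cons_of_mem h)
    have hr1 : (1, 1) ∉ r := fun h => hs01.2 (Multiset.mem_cons_of_mem h)
    have hr : p.parts = {(1, d), (m, c)} + r := by simp [hs]
    obtain ⟨q, hq⟩ := p.exists_parts_eq_add (n := n)
      (b := Multiset.replicate (m - 1) (1, c)) hr
      (fun x hx => by simp [Multiset.eq_of_mem_replicate hx])
      (fun x hx => by simpa [Multiset.eq_of_mem_replicate hx] using hc)
      (by simp; omega)
    have hmerge := mergeOnes_replicate_add (j := 1) (k := m - 1) (by omega) hc hr0 hr1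
    rw [← hq, Nat.sub_add_cancel (by omega)] at hmerge
    have hz : ¬ q.parts.count (1, 0) + q.parts.count (1, 1) ≤ 1 := by
      rw [hq]
      interval_cases c <;> simp [Multiset.count_replicate] <;> omega
    interval_cases d
    · exact ⟨q, 3, by rw [raiseByTwo, if_neg hz, hmerge, hs]⟩
    · exact ⟨q, 4, by rw [raiseByTwo, if_neg hz, hmerge, hs]⟩
  · have hs0 : (1, 0) ∉ p.parts := fun h => hones ⟨0, by omega, h⟩
    have hs1 : (1, 1) ∉ p.parts := fun h => hones ⟨1, by omega, h⟩
    obtain ⟨⟨m, c⟩, hx⟩ : ∃ x, x ∈ p.parts := by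
      refine Multiset.exists_mem_of_ne_zero fun h => ?_
      have := p.parts_sum
      simp [h] at this
    have hc : c < 2 := p.parts_color _ hx
    have hm : 3 ≤ m := by
      refine hlarge _ hx ?_
      rintro rfl
      exact hones ⟨c, hc, hx⟩
    obtain ⟨r, hs⟩ := Multiset.exists_cons_of_mem hx
    have hr0 : (1, 0) ∉ r := fun h => hs0 (hs ▸ Multiset.mem_cons_of_mem h)
    have hr1 : (1, 1) ∉ r := fun h => hs1 (hs ▸ Multiset.mem_cons_of_mem h)
    have hr : p.parts = {(m, c)} + r := by simp [hs]
    obtain ⟨q, hq⟩ := p.exists_parts_eq_add (n := n)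
      (b := Multiset.replicate (m - 2) (1, c)) hr
      (fun x hx => by simp [Multiset.eq_of_mem_replicate hx])
      (fun x hx => by simpa [Multiset.eq_of_mem_replicate hx] using hc)
      (by simp; omega)
    have hmerge := mergeOnes_replicate_add (j := 2) (k := m - 2) (by omega) hc hr0 hr1
    rw [← hq, Nat.sub_add_cancel (by omega)] at hmerge
    have hz : ¬ q.parts.count (1, 0) + q.parts.count (1, 1) = 0 := by
      rw [hq]
      interval_cases c <;> simp [Multiset.mem_replicate] <;> omega
    exact ⟨q, 2, by rw [raiseByTwo, if_neg hz, hmerge, hs]⟩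

theorem exists_injective_prod_fin_five (n : ℕ) :
    ∃ f : ColoredPartition 2 (n + 2) → ColoredPartition 2 n × Fin 5, Function.Injective f := by
  choose q t h using exists_raiseByTwo_eq (n := n)
  refine ⟨fun p => (q p, t p), fun p p' hp => parts_injective _ _ ?_⟩
  obtain ⟨hq, ht⟩ := Prod.mk.inj hp
  rw [← h p, ← h p', hq, ht]

instance (k : ℕ) : Subsingleton (ColoredPartition k 0) where
  allEq p q := by
    have key : ∀ p : ColoredPartition k 0, p.parts = 0 := fun p =>
      Multiset.eq_zero_of_forall_notMem fun x hx => (p.parts_pos x hx).ne' <|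
        Multiset.sum_eq_zero_iff.1 p.parts_sum _ (Multiset.mem_map_of_mem _ hx)
    exact parts_injective _ _ ((key p).trans (key q).symm)

theorem exists_parts_eq_singleton {k : ℕ} (p : ColoredPartition k 1) :
    ∃ c : Fin k, p.parts = {(1, (c : ℕ))} := by
  obtain ⟨⟨m, c⟩, hx⟩ : ∃ x, x ∈ p.parts := by
    refine Multiset.exists_mem_of_ne_zero fun h => ?_
    have := p.parts_sum
    simp [h] at this
  have hm : 0 < m := p.parts_pos _ hx
  obtain ⟨r, hr⟩ := Multiset.exists_cons_of_mem hx
  have hsum := p.parts_sum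
  rw [hr, Multiset.map_cons, Multiset.sum_cons] at hsum
  simp only at hsum
  obtain rfl : m = 1 := by omega
  have hr0 : r = 0 := Multiset.eq_zero_of_forall_notMem fun x hx =>
    (p.parts_pos x (hr ▸ Multiset.mem_cons_of_mem hx)).ne' <|
      Multiset.sum_eq_zero_iff.1 (by omega) _ (Multiset.mem_map_of_mem Prod.fst hx)
  exact ⟨⟨c, p.parts_color _ hx⟩, by rw [hr, hr0]; rfl⟩

theorem exists_injective_fin (k : ℕ) :
    ∃ f : ColoredPartition k 1 → Fin k, Function.Injective f := by
  choose c h using exists_parts_eq_singleton (k := k)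
  exact ⟨c, fun p q hpq => parts_injective _ _ (by rw [h p, h q, hpq])⟩

instance finite_two (n : ℕ) : Finite (ColoredPartition 2 n) := by
  induction n using Nat.twoStepInduction with
  | zero => infer_instance
  | one =>
    obtain ⟨f, hf⟩ := exists_injective_fin 2
    exact Finite.of_injective f hf
  | more n ih _ =>
    obtain ⟨f, hf⟩ := exists_injective_prod_fin_five n
    exact Finite.of_injective f hf

/-- The two-colored partitions of `1`. -/
def ofOne (c : Fin 2) : ColoredPartition 2 1 where
  parts := {(1, (c : ℕ))}
  parts_pos := by simp
  parts_color := by revert c; decide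
  parts_sum := by simp

/-- The two-colored partitions of `2`. -/
def ofTwo (t : Fin 5) : ColoredPartition 2 2 where
  parts := raiseByTwo 0 t
  parts_pos := by revert t; decide
  parts_color := by revert t; decide
  parts_sum := by revert t; decide

end ColoredPartition

open ColoredPartition

theorem coloredPartitions_two_zero_le : coloredPartitions 2 0 ≤ 1 :=
  Finite.card_le_one_iff_subsingleton.2 inferInstance

theorem coloredPartitions_two_add_two_le (n : ℕ) :
    coloredPartitions 2 (n + 2) ≤ 5 * coloredPartitions 2 n := by
  obtain ⟨f, hf⟩ := exists_injective_prod_fin_five n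
  simpa [coloredPartitions, mul_comm] using Nat.card_le_card_of_injective f hf

theorem coloredPartitions_two_one : coloredPartitions 2 1 = 2 := by
  apply le_antisymm
  · obtain ⟨f, hf⟩ := exists_injective_fin 2
    simpa [coloredPartitions] using Nat.card_le_card_of_injective f hf
  · have hf : Function.Injective ofOne := fun c d h => by
      simpa [ofOne, Fin.ext_iff] using congrArg parts h
    simpa [coloredPartitions] using Nat.card_le_card_of_injective _ hf

theorem coloredPartitions_two_two : coloredPartitions 2 2 = 5 := by
  apply le_antisymm
  · have := coloredPartitions_two_add_two_le 0
    have := coloredPartitions_two_zero_le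
    simp only [zero_add] at *
    omega
  · have hraise : Function.Injective (raiseByTwo 0) := by decide
    have hf : Function.Injective ofTwo := fun c d h => hraise (congrArg parts h)
    simpa [coloredPartitions] using Nat.card_le_card_of_injective _ hf

theorem two_pow_mod_mul_five_pow_div (n : ℕ) :
    (if Even n then 5 ^ (n / 2) else 2 * 5 ^ ((n - 1) / 2)) = 2 ^ (n % 2) * 5 ^ (n / 2) := by
  rcases Nat.even_or_odd' n with ⟨m, rfl | rfl⟩
  · simp
  · have h : (2 * m + 1) / 2 = m := by omega
    simp [h]

theorem coloredPartitions_two_le (n : ℕ) :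
    coloredPartitions 2 n ≤ 2 ^ (n % 2) * 5 ^ (n / 2) := by
  induction n using Nat.twoStepInduction with
  | zero => simpa using coloredPartitions_two_zero_le
  | one => simp [coloredPartitions_two_one]
  | more n ih _ =>
    calc coloredPartitions 2 (n + 2) ≤ 5 * coloredPartitions 2 n :=
          coloredPartitions_two_add_two_le n
      _ ≤ 5 * (2 ^ (n % 2) * 5 ^ (n / 2)) := by gcongr
      _ = 2 ^ ((n + 2) % 2) * 5 ^ ((n + 2) / 2) := by
          rw [Nat.add_mod_right, Nat.add_div_right n two_pos, pow_succ]
          ring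

theorem two_pow_mod_mul_five_pow_div_mul_le (a b : ℕ) :
    2 ^ (a % 2) * 5 ^ (a / 2) * (2 ^ (b % 2) * 5 ^ (b / 2)) ≤
      2 ^ ((a + b) % 2) * 5 ^ ((a + b) / 2) := by
  have key : 2 ^ (a % 2) * 5 ^ (a / 2) * (2 ^ (b % 2) * 5 ^ (b / 2)) =
      2 ^ (a % 2 + b % 2) * 5 ^ (a / 2 + b / 2) := by ring
  rw [key]
  rcases Nat.lt_or_ge (a % 2 + b % 2) 2 with h | h
  · have h1 : (a + b) % 2 = a % 2 + b % 2 := by omega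
    have h2 : (a + b) / 2 = a / 2 + b / 2 := by omega
    rw [h1, h2]
  · have h1 : a % 2 + b % 2 = 2 := by omega
    have h2 : (a + b) % 2 = 0 := by omega
    have h3 : (a + b) / 2 = a / 2 + b / 2 + 1 := by omega
    rw [h1, h2, h3, pow_succ]
    have : 0 < 5 ^ (a / 2 + b / 2) := by positivity
    omega

theorem prod_map_coloredPartitions_two_le (s : Multiset ℕ) :
    (s.map (coloredPartitions 2)).prod ≤ 2 ^ (s.sum % 2) * 5 ^ (s.sum / 2) := by
  induction s using Multiset.induction_on with
  | empty => simp
  | cons a s ih =>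
    rw [Multiset.map_cons, Multiset.prod_cons, Multiset.sum_cons]
    exact (Nat.mul_le_mul (coloredPartitions_two_le a) ih).trans
      (two_pow_mod_mul_five_pow_div_mul_le a s.sum)

theorem max_two_colored (n : ℕ) (hn : 1 ≤ n) :
    (∀ lam : Nat.Partition n,
      (lam.parts.map (coloredPartitions 2)).prod ≤
        if Even n then 5 ^ (n / 2) else 2 * 5 ^ ((n - 1) / 2)) ∧
    (∃ lam : Nat.Partition n,
      (lam.parts.map (coloredPartitions 2)).prod =
        if Even n then 5 ^ (n / 2) else 2 * 5 ^ ((n - 1) / 2)) := by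
  rw [two_pow_mod_mul_five_pow_div]
  refine ⟨fun lam => ?_, ⟨Multiset.replicate (n % 2) 1 + Multiset.replicate (n / 2) 2, ?_, ?_⟩, ?_⟩
  · simpa only [lam.parts_sum] using prod_map_coloredPartitions_two_le lam.parts
  · intro i hi
    rcases Multiset.mem_add.1 hi with hi | hi <;> simp [Multiset.eq_of_mem_replicate hi]
  · simp
    omega
  · simp [coloredPartitions_two_one, coloredPartitions_two_two]
end

section
/- For every integer n ≥ 1, the maximal value of the extended 3-colored partition function p_{-3}(λ) = ∏_j p_{-3}(λ_j) over all (ordinary) partitions λ of n equals 3^n; in particular, for every partition λ of n one has ∏_j p_{-3}(λ_j) ≤ 3^n, with equality attained exactly by the partitions of n all of whose parts are 1 or 2. -/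
namespace ColoredPartition

@[ext]
theorem ext {k n : ℕ} {p q : ColoredPartition k n} (h : p.parts = q.parts) : p = q := by
  cases p; cases q; simpa using h

theorem parts_eq_zero {k : ℕ} (p : ColoredPartition k 0) : p.parts = 0 := by
  refine Multiset.eq_zero_of_forall_notMem fun x hx => (p.parts_pos x hx).ne' ?_
  exact Multiset.sum_eq_zero_iff.1 p.parts_sum x.1 (Multiset.mem_map_of_mem _ hx)

instance {k : ℕ} : Unique (ColoredPartition k 0) where
  default := ⟨0, by simp, by simp, by simp⟩
  uniq p := by ext1; exact p.parts_eq_zero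

/-- Turn a multiset of colored parts and a color `c` into a multiset with sum larger by one:
if no part `1` has a color below `c`, add the part `(1, c)`; otherwise merge all parts of size `1`,
together with one additional unit, into a single part. -/
def growParts (s : Multiset (ℕ × ℕ)) (c : ℕ) : Multiset (ℕ × ℕ) :=
  if ∃ a < c, (1, a) ∈ s then
    (s.countP (·.1 = 1) + 1, if (1, 0) ∈ s then c - 1 else c) ::ₘ s.filter (¬ ·.1 = 1)
  else (1, c) ::ₘ s

theorem countP_one_add_sum_filter (s : Multiset (ℕ × ℕ)) :
    s.countP (·.1 = 1) + ((s.filter (¬ ·.1 = 1)).map Prod.fst).sum = (s.map Prod.fst).sum := by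
  induction s using Multiset.induction_on with
  | empty => simp
  | cons x s ih =>
    by_cases hx : x.1 = 1
    · rw [Multiset.countP_cons_of_pos (p := fun x : ℕ × ℕ => x.1 = 1) _ hx,
        Multiset.filter_cons_of_neg (p := fun x : ℕ × ℕ => ¬ x.1 = 1) _ (not_not.2 hx),
        Multiset.map_cons, Multiset.sum_cons, ← ih, hx]
      omega
    · rw [Multiset.countP_cons_of_neg (p := fun x : ℕ × ℕ => x.1 = 1) _ hx,
        Multiset.filter_cons_of_pos (p := fun x : ℕ × ℕ => ¬ x.1 = 1) _ hx,
        Multiset.map_cons, Multiset.map_cons, Multiset.sum_cons, Multiset.sum_cons, ← ih]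
      omega

/-- The colored partition of `n + 1` with parts given by `growParts`. -/
def grow {k n : ℕ} (x : ColoredPartition k n × Fin k) : ColoredPartition k (n + 1) where
  parts := growParts x.1.parts x.2
  parts_pos p hp := by
    have h := x.1.parts_pos
    unfold growParts at hp
    split_ifs at hp <;> simp only [Multiset.mem_cons, Multiset.mem_filter] at hp <;>
      rcases hp with rfl | hp
    all_goals first | exact Nat.succ_pos _ | exact h p hp.1 | exact h p hp
  parts_color p hp := by
    have h := x.1.parts_color
    have hc := x.2.2
    unfold growParts at hp
    split_ifs at hp <;> simp only [Multiset.mem_cons, Multiset.mem_filter] at hp <;>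
      rcases hp with rfl | hp
    all_goals first | exact h p hp.1 | exact h p hp | (dsimp only; omega)
  parts_sum := by
    have h := countP_one_add_sum_filter x.1.parts
    rw [x.1.parts_sum] at h
    unfold growParts
    split_ifs <;> rw [Multiset.map_cons, Multiset.sum_cons]
    · exact (Nat.add_right_comm _ _ _).trans (congrArg (· + 1) h)
    · exact (Nat.add_right_comm _ _ _).trans (congrArg (· + 1) h)
    · rw [x.1.parts_sum, add_comm]

theorem growParts_erase_one {s : Multiset (ℕ × ℕ)} {c : ℕ} (hc : (1, c) ∈ s)
    (hmin : ∀ a < c, (1, a) ∉ s) : growParts (s.erase (1, c)) c = s := by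
  rw [growParts, if_neg, Multiset.cons_erase hc]
  rintro ⟨a, ha, h⟩
  exact hmin a ha (Multiset.mem_of_mem_erase h)

theorem growParts_replicate_add {s : Multiset (ℕ × ℕ)} (hs : ∀ x ∈ s, x.1 ≠ 1) {m a c : ℕ}
    (hm : m ≠ 0) (hac : a < c) :
    growParts (Multiset.replicate m (1, a) + s) c =
      (m + 1, if a = 0 then c - 1 else c) ::ₘ s := by
  have hmem (b : ℕ) : (1, b) ∈ Multiset.replicate m (1, a) + s ↔ b = a := by
    have : (1, b) ∉ s := fun h => hs _ h rfl
    simp [Multiset.mem_replicate, hm, this]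
  have hcount : s.countP (·.1 = 1) = 0 := Multiset.countP_eq_zero.2 hs
  have hfilter : s.filter (¬ ·.1 = 1) = s := Multiset.filter_eq_self.2 hs
  have hcount' : (Multiset.replicate m ((1, a) : ℕ × ℕ)).countP (·.1 = 1) = m := by
    rw [Multiset.countP_eq_card.2, Multiset.card_replicate]
    intro x hx
    rw [Multiset.eq_of_mem_replicate hx]
  have hfilter' : (Multiset.replicate m ((1, a) : ℕ × ℕ)).filter (¬ ·.1 = 1) = 0 := by
    rw [Multiset.filter_eq_nil]
    intro x hx
    simp [Multiset.eq_of_mem_replicate hx]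
  rw [growParts, if_pos ⟨a, hac, (hmem a).2 rfl⟩, Multiset.countP_add, Multiset.filter_add,
    hcount, hfilter, hcount', hfilter']
  simp only [hmem, add_zero, zero_add, eq_comm]

theorem grow_surjective (n : ℕ) :
    Function.Surjective (grow : ColoredPartition 3 n × Fin 3 → ColoredPartition 3 (n + 1)) := by
  intro q
  have hpos := q.parts_pos
  have hcol := q.parts_color
  by_cases h1 : ∃ c, (1, c) ∈ q.parts
  · classical
    have hc := Nat.find_spec h1
    set c := Nat.find h1 with hcdef
    have hsum : ((q.parts.erase (1, c)).map Prod.fst).sum = n := by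
      have h := q.parts_sum
      rw [← Multiset.cons_erase hc, Multiset.map_cons, Multiset.sum_cons] at h
      dsimp only at h
      omega
    refine ⟨(⟨q.parts.erase (1, c), fun p hp => hpos p (Multiset.mem_of_mem_erase hp),
      fun p hp => hcol p (Multiset.mem_of_mem_erase hp), hsum⟩, ⟨c, hcol _ hc⟩), ?_⟩
    ext1
    exact growParts_erase_one hc fun a ha => Nat.find_min h1 ha
  · push Not at h1
    obtain ⟨⟨m, d⟩, hmd⟩ : ∃ x, x ∈ q.parts := by
      refine Multiset.exists_mem_of_ne_zero fun h0 => ?_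
      have h := q.parts_sum
      simp [h0] at h
    have hd : d < 3 := hcol _ hmd
    have hm0 : 0 < m := hpos _ hmd
    have hm1 : m ≠ 1 := fun h => h1 d (h ▸ hmd)
    obtain ⟨a, c, hac, hc, hd'⟩ : ∃ a c, a < c ∧ c < 3 ∧ (if a = 0 then c - 1 else c) = d := by
      interval_cases d
      · exact ⟨0, 1, by simp⟩
      · exact ⟨0, 2, by simp⟩
      · exact ⟨1, 2, by simp⟩
    have hsum : m + ((q.parts.erase (m, d)).map Prod.fst).sum = n + 1 := by
      have h := q.parts_sum
      rwa [← Multiset.cons_erase hmd, Multiset.map_cons, Multiset.sum_cons] at h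
    refine ⟨(⟨Multiset.replicate (m - 1) (1, a) + q.parts.erase (m, d), ?_, ?_, ?_⟩, ⟨c, hc⟩), ?_⟩
    · intro p hp
      rcases Multiset.mem_add.1 hp with hp | hp
      · simp [Multiset.eq_of_mem_replicate hp]
      · exact hpos p (Multiset.mem_of_mem_erase hp)
    · intro p hp
      rcases Multiset.mem_add.1 hp with hp | hp
      · rw [Multiset.eq_of_mem_replicate hp]
        exact hac.trans hc
      · exact hcol p (Multiset.mem_of_mem_erase hp)
    · rw [Multiset.map_add, Multiset.sum_add, Multiset.map_replicate, Multiset.sum_replicate,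
        smul_eq_mul, mul_one]
      omega
    · ext1
      refine (growParts_replicate_add ?_ (by omega) hac).trans ?_
      · rintro ⟨x, e⟩ hx rfl
        exact h1 e (Multiset.mem_of_mem_erase hx)
      · rw [hd', Nat.sub_add_cancel hm0, Multiset.cons_erase hmd]

theorem grow_not_injective {n : ℕ} (hn : 2 ≤ n) :
    ¬ Function.Injective (grow : ColoredPartition 3 n × Fin 3 → ColoredPartition 3 (n + 1)) := by
  obtain ⟨m, rfl⟩ : ∃ m, n = m + 2 := ⟨n - 2, by omega⟩
  have key (a : ℕ) (ha : a < 2) : ∃ p : ColoredPartition 3 (m + 2),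
      p.parts = (1, a) ::ₘ Multiset.replicate (m + 1) (1, 0) := by
    refine ⟨⟨(1, a) ::ₘ Multiset.replicate (m + 1) (1, 0), ?_, ?_, ?_⟩, rfl⟩
    · intro p hp
      rcases Multiset.mem_cons.1 hp with rfl | hp
      · simp
      · simp [Multiset.eq_of_mem_replicate hp]
    · intro p hp
      rcases Multiset.mem_cons.1 hp with rfl | hp
      · exact ha.trans (by norm_num)
      · simp [Multiset.eq_of_mem_replicate hp]
    · rw [Multiset.map_cons, Multiset.map_replicate, Multiset.sum_cons, Multiset.sum_replicate]
      simp only [smul_eq_mul]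
      omega
  have hgrow (a : ℕ) : growParts ((1, a) ::ₘ Multiset.replicate (m + 1) (1, 0)) 2 =
      {(m + 3, 1)} := by
    have h0 : ((1, 0) : ℕ × ℕ) ∈ (1, a) ::ₘ Multiset.replicate (m + 1) (1, 0) := by
      simp [Multiset.mem_replicate]
    have hone : ∀ x ∈ (1, a) ::ₘ Multiset.replicate (m + 1) ((1, 0) : ℕ × ℕ), x.1 = 1 := by
      intro x hx
      rcases Multiset.mem_cons.1 hx with rfl | hx
      · rfl
      · rw [Multiset.eq_of_mem_replicate hx]
    rw [growParts, if_pos ⟨0, by norm_num, h0⟩, if_pos h0, Multiset.countP_eq_card.2 hone,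
      Multiset.filter_eq_nil.2 fun x hx => not_not.2 (hone x hx)]
    simp
  obtain ⟨p, hp⟩ := key 0 (by norm_num)
  obtain ⟨q, hq⟩ := key 1 (by norm_num)
  intro hinj
  have hpq : grow (p, (2 : Fin 3)) = grow (q, (2 : Fin 3)) := by
    ext1
    change growParts p.parts 2 = growParts q.parts 2
    rw [hp, hq, hgrow, hgrow]
  have h := congrArg (fun x => x.1.parts) (hinj hpq)
  simp only [hp, hq] at h
  simp at h

instance finite_three (n : ℕ) : Finite (ColoredPartition 3 n) := by
  induction n with
  | zero => infer_instance
  | succ n ih => exact Finite.of_surjective _ (grow_surjective n)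

end ColoredPartition

open ColoredPartition

theorem coloredPartitions_zero (k : ℕ) : coloredPartitions k 0 = 1 := Nat.card_unique

theorem coloredPartitions_three_succ_le (n : ℕ) :
    coloredPartitions 3 (n + 1) ≤ coloredPartitions 3 n * 3 := by
  simpa [coloredPartitions] using Nat.card_le_card_of_surjective _ (grow_surjective n)

theorem coloredPartitions_three_succ_lt {n : ℕ} (hn : 2 ≤ n) :
    coloredPartitions 3 (n + 1) < coloredPartitions 3 n * 3 := by
  refine (coloredPartitions_three_succ_le n).lt_of_ne fun h => grow_not_injective hn ?_
  refine ((Nat.bijective_iff_surjective_and_card _).2 ⟨grow_surjective n, ?_⟩).1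
  simpa [coloredPartitions] using h.symm

theorem coloredPartitions_three_le (n : ℕ) : coloredPartitions 3 n ≤ 3 ^ n := by
  induction n with
  | zero => simp [coloredPartitions_zero]
  | succ n ih =>
    rw [pow_succ]
    exact (coloredPartitions_three_succ_le n).trans (Nat.mul_le_mul_right 3 ih)

theorem coloredPartitions_three_lt {n : ℕ} (hn : 3 ≤ n) : coloredPartitions 3 n < 3 ^ n := by
  obtain ⟨m, rfl⟩ : ∃ m, n = m + 1 := ⟨n - 1, by omega⟩
  rw [pow_succ]
  exact (coloredPartitions_three_succ_lt (by omega)).trans_le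
    (Nat.mul_le_mul_right 3 (coloredPartitions_three_le m))

theorem nine_le_coloredPartitions_three_two : 9 ≤ coloredPartitions 3 2 := by
  let parts (x : Fin 3 × Fin 3) : Multiset (ℕ × ℕ) :=
    if x.1 ≤ x.2 then {(1, x.1.val), (1, x.2.val)} else {(2, x.1.val + x.2.val - 1)}
  have hinj : Function.Injective parts := by decide
  let f (x : Fin 3 × Fin 3) : ColoredPartition 3 2 :=
    ⟨parts x, by revert x; decide, by revert x; decide, by revert x; decide⟩
  have hf : Function.Injective f := fun x y h => hinj (congrArg ColoredPartition.parts h)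
  simpa [coloredPartitions] using Nat.card_le_card_of_injective f hf

theorem coloredPartitions_three_two : coloredPartitions 3 2 = 3 ^ 2 :=
  (coloredPartitions_three_le 2).antisymm nine_le_coloredPartitions_three_two

theorem coloredPartitions_three_one : coloredPartitions 3 1 = 3 ^ 1 := by
  have h1 := coloredPartitions_three_le 1
  have h2 := coloredPartitions_three_succ_le 1
  rw [coloredPartitions_three_two] at h2
  omega

theorem coloredPartitions_three_eq_iff {n : ℕ} (hn : 0 < n) :
    coloredPartitions 3 n = 3 ^ n ↔ n = 1 ∨ n = 2 := by
  constructor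
  · intro h
    by_contra! hne
    exact (coloredPartitions_three_lt (by omega)).ne h
  · rintro (rfl | rfl)
    exacts [coloredPartitions_three_one, coloredPartitions_three_two]

theorem Nat.mul_eq_mul_iff_of_le {a b c d : ℕ} (hab : a ≤ b) (hcd : c ≤ d) (hb : 0 < b)
    (hd : 0 < d) : a * c = b * d ↔ a = b ∧ c = d := by
  refine ⟨fun h => ⟨?_, ?_⟩, fun h => h.1 ▸ h.2 ▸ rfl⟩
  · by_contra hne
    exact (Nat.mul_lt_mul_of_lt_of_le (hab.lt_of_ne hne) hcd hd).ne h
  · by_contra hne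
    exact (Nat.mul_lt_mul_of_le_of_lt hab (hcd.lt_of_ne hne) hb).ne h

theorem prod_coloredPartitions_three (s : Multiset ℕ) (hs : ∀ i ∈ s, 0 < i) :
    (s.map (coloredPartitions 3)).prod ≤ 3 ^ s.sum ∧
      ((s.map (coloredPartitions 3)).prod = 3 ^ s.sum ↔ ∀ i ∈ s, i = 1 ∨ i = 2) := by
  induction s using Multiset.induction_on with
  | empty => simp
  | cons m s ih =>
    obtain ⟨hle, heq⟩ := ih fun i hi => hs i (Multiset.mem_cons_of_mem hi)
    have hm := coloredPartitions_three_le m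
    rw [Multiset.map_cons, Multiset.prod_cons, Multiset.sum_cons, pow_add,
      Nat.mul_eq_mul_iff_of_le hm hle (by positivity) (by positivity), heq,
      coloredPartitions_three_eq_iff (hs m (Multiset.mem_cons_self m s)),
      Multiset.forall_mem_cons]
    exact ⟨Nat.mul_le_mul hm hle, Iff.rfl⟩

theorem max_three_colored (n : ℕ) (hn : 1 ≤ n) :
    ∀ lam : Nat.Partition n,
      (lam.parts.map (coloredPartitions 3)).prod ≤ 3 ^ n ∧
      ((lam.parts.map (coloredPartitions 3)).prod = 3 ^ n ↔
        ∀ i ∈ lam.parts, i = 1 ∨ i = 2) := by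
  intro lam
  have h := prod_coloredPartitions_three lam.parts fun _ hi => lam.parts_pos hi
  rwa [lam.parts_sum] at h
end

section
/- For every integer k ≥ 4 and every integer n ≥ 1, the maximal value of the extended k-colored partition function p_{-k}(λ) = ∏_j p_{-k}(λ_j) over all (ordinary) partitions λ of n equals k^n, and it is attained exactly at the partition (1, 1, …, 1) consisting of n parts equal to 1; in particular, for every other partition λ of n one has ∏_j p_{-k}(λ_j) < k^n. -/
namespace ColoredPartition

@[ext]
theorem ext_parts {k n : ℕ} {a b : ColoredPartition k n} (h : a.parts = b.parts) : a = b := by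
  cases a; cases b; cases h; rfl

/-- Recolouring used to spread a part `m + 1` of color `c` into `m` ones. -/
def spreadColor (k c : ℕ) : ℕ := if c + 1 = k then 0 else c

/-- Tag recording, together with `spreadColor k c`, the original color `c`. -/
def spreadTag (k c : ℕ) : ℕ := if c + 1 = k then 2 else c + 1

/-- `Lowers k l t u` says that the multiset `l` of colored parts is encoded by the pair `(t, u)`,
where the part sizes of `u` sum to one less than those of `l`: either a one of least color `t` is
removed from `l`, or `l` has no ones and some part of size `m + 1` is replaced by `m` ones. -/
def Lowers (k : ℕ) (l : Multiset (ℕ × ℕ)) (t : ℕ) (u : Multiset (ℕ × ℕ)) : Prop :=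
  (l = (1, t) ::ₘ u ∧ ∀ d < t, (1, d) ∉ u) ∨
  ∃ m c s, 0 < m ∧ l = (m + 1, c) ::ₘ s ∧ (∀ d, (1, d) ∉ s) ∧
    u = s + Multiset.replicate m (1, spreadColor k c) ∧ t = spreadTag k c

theorem mem_add_replicate {α : Type*} {m : ℕ} (hm : 0 < m) (s : Multiset α) (a : α) :
    a ∈ s + Multiset.replicate m a :=
  Multiset.mem_add.2 (Or.inr (Multiset.mem_replicate.2 ⟨hm.ne', rfl⟩))

theorem spreadColor_lt_spreadTag (k c : ℕ) : spreadColor k c < spreadTag k c := by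
  unfold spreadColor spreadTag; split_ifs <;> omega

theorem eq_of_spread_eq {k c d : ℕ} (h₁ : spreadColor k c = spreadColor k d)
    (h₂ : spreadTag k c = spreadTag k d) : c = d := by
  unfold spreadColor at h₁; unfold spreadTag at h₂
  split_ifs at h₁ h₂ <;> omega

theorem Lowers.left_unique {k t : ℕ} {l l' u : Multiset (ℕ × ℕ)}
    (h : Lowers k l t u) (h' : Lowers k l' t u) : l = l' := by
  rcases h with ⟨rfl, h⟩ | ⟨m, c, s, hm, rfl, hs, rfl, rfl⟩
  · rcases h' with ⟨rfl, -⟩ | ⟨m, c, s, hm, rfl, hs, rfl, rfl⟩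
    · rfl
    · exact absurd (mem_add_replicate hm _ _) (h _ (spreadColor_lt_spreadTag k c))
  · rcases h' with ⟨rfl, h⟩ | ⟨m', c', s', hm', rfl, hs', hu, ht⟩
    · exact absurd (mem_add_replicate hm _ _) (h _ (spreadColor_lt_spreadTag k c))
    · have hmem : (1, spreadColor k c) ∈ s' + Multiset.replicate m' (1, spreadColor k c') := by
        rw [← hu]; exact mem_add_replicate hm _ _
      have hcol : spreadColor k c = spreadColor k c' := by
        rcases Multiset.mem_add.1 hmem with h | h
        · exact absurd h (hs' _)
        · exact congrArg Prod.snd (Multiset.eq_of_mem_replicate h)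
      obtain rfl := eq_of_spread_eq hcol ht
      have hcount := congrArg (Multiset.count (1, spreadColor k c)) hu
      simp only [Multiset.count_add, Multiset.count_replicate_self,
        Multiset.count_eq_zero_of_notMem (hs _), Multiset.count_eq_zero_of_notMem (hs' _),
        zero_add] at hcount
      subst hcount
      rw [add_right_cancel hu]

theorem exists_lowers {k n : ℕ} (hk : 3 ≤ k) (l : ColoredPartition k (n + 1)) :
    ∃ x : Fin k × ColoredPartition k n, Lowers k l.parts x.1 x.2.parts := by
  classical
  obtain ⟨l, hpos, hcol, hsum⟩ := l
  by_cases h : ∃ c, (1, c) ∈ l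
  · obtain ⟨u, hu⟩ := Multiset.exists_cons_of_mem (Nat.find_spec h)
    have hmin : ∀ d < Nat.find h, (1, d) ∉ u := fun d hd hdu =>
      Nat.find_min h hd (by rw [hu]; exact Multiset.mem_cons_of_mem hdu)
    refine ⟨(⟨Nat.find h, hcol _ (Nat.find_spec h)⟩, ⟨u, fun p hp => hpos p ?_,
      fun p hp => hcol p ?_, ?_⟩), Or.inl ⟨hu, hmin⟩⟩
    · rw [hu]; exact Multiset.mem_cons_of_mem hp
    · rw [hu]; exact Multiset.mem_cons_of_mem hp
    · rw [hu, Multiset.map_cons, Multiset.sum_cons] at hsum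
      dsimp only at hsum
      omega
  · push Not at h
    have hne : l ≠ 0 := by rintro rfl; simp at hsum
    obtain ⟨⟨a, c⟩, hac⟩ := Multiset.exists_mem_of_ne_zero hne
    obtain ⟨s, rfl⟩ := Multiset.exists_cons_of_mem hac
    have ha : 0 < a := hpos _ hac
    have ha1 : a ≠ 1 := by rintro rfl; exact h c hac
    have hc : c < k := hcol _ hac
    obtain ⟨m, rfl⟩ := Nat.exists_eq_succ_of_ne_zero ha.ne'
    have hm : 0 < m := by omega
    have htag : spreadTag k c < k := by unfold spreadTag; split_ifs <;> omega
    refine ⟨(⟨spreadTag k c, htag⟩,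
      ⟨s + Multiset.replicate m (1, spreadColor k c), fun p hp => ?_, fun p hp => ?_, ?_⟩),
      Or.inr ⟨m, c, s, hm, rfl, fun d hd => h d (Multiset.mem_cons_of_mem hd), rfl, rfl⟩⟩
    · rcases Multiset.mem_add.1 hp with hp | hp
      · exact hpos p (Multiset.mem_cons_of_mem hp)
      · rw [Multiset.eq_of_mem_replicate hp]; exact one_pos
    · rcases Multiset.mem_add.1 hp with hp | hp
      · exact hcol p (Multiset.mem_cons_of_mem hp)
      · rw [Multiset.eq_of_mem_replicate hp]
        exact (spreadColor_lt_spreadTag k c).trans htag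
    · simp at hsum ⊢
      omega

/-- A choice of encoding of each colored partition of `n + 1`. -/
noncomputable def lower {k n : ℕ} (hk : 3 ≤ k) (l : ColoredPartition k (n + 1)) :
    Fin k × ColoredPartition k n :=
  (exists_lowers hk l).choose

theorem lowers_lower {k n : ℕ} (hk : 3 ≤ k) (l : ColoredPartition k (n + 1)) :
    Lowers k l.parts (lower hk l).1 (lower hk l).2.parts :=
  (exists_lowers hk l).choose_spec

theorem lower_injective {k n : ℕ} (hk : 3 ≤ k) :
    Function.Injective (lower (n := n) hk) := fun l l' h =>
  ext_parts ((lowers_lower hk l).left_unique (h ▸ lowers_lower hk l'))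

instance subsingleton_zero (k : ℕ) : Subsingleton (ColoredPartition k 0) := by
  have key (a : ColoredPartition k 0) : a.parts = 0 := by
    refine Multiset.eq_zero_of_forall_notMem fun p hp => (a.parts_pos p hp).ne' ?_
    exact Multiset.sum_eq_zero_iff.1 a.parts_sum _ (Multiset.mem_map_of_mem _ hp)
  exact ⟨fun a b => ext_parts ((key a).trans (key b).symm)⟩

theorem finite {k : ℕ} (hk : 3 ≤ k) (n : ℕ) : Finite (ColoredPartition k n) := by
  induction n with
  | zero => infer_instance
  | succ n ih => exact Finite.of_injective _ (lower_injective hk)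

/-- The partition of `n` into `n` ones, all of the same color `c`. -/
def ones {k : ℕ} (n : ℕ) (c : Fin k) : ColoredPartition k n where
  parts := Multiset.replicate n (1, c)
  parts_pos p hp := by rw [Multiset.eq_of_mem_replicate hp]; exact one_pos
  parts_color p hp := by rw [Multiset.eq_of_mem_replicate hp]; exact c.2
  parts_sum := by simp

theorem lower_not_surjective {k n : ℕ} (hk : 4 ≤ k) (hn : 1 ≤ n) :
    ¬ Function.Surjective (lower (n := n) (k := k) (by omega)) := by
  intro hsurj
  obtain ⟨l, hl⟩ := hsurj (⟨3, by omega⟩, ones n ⟨0, by omega⟩)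
  have h := lowers_lower (by omega) l
  rw [hl] at h
  have hn0 : n ≠ 0 := by omega
  rcases h with ⟨-, h⟩ | ⟨m, c, s, hm, -, -, hu, ht⟩
  · exact h 0 (by simp) (Multiset.mem_replicate.2 ⟨hn0, rfl⟩)
  · have hmem : (1, spreadColor k c) ∈ Multiset.replicate n (1, 0) := by
      change Multiset.replicate n (1, 0) = _ at hu
      rw [hu]; exact mem_add_replicate hm _ _
    have hcol := congrArg Prod.snd (Multiset.eq_of_mem_replicate hmem)
    dsimp only at hcol ht
    unfold spreadColor at hcol
    unfold spreadTag at ht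
    split_ifs at hcol ht
    all_goals omega

end ColoredPartition

open ColoredPartition in
theorem coloredPartitions_succ_le {k : ℕ} (hk : 3 ≤ k) (n : ℕ) :
    coloredPartitions k (n + 1) ≤ k * coloredPartitions k n := by
  have := ColoredPartition.finite hk n
  simpa [coloredPartitions] using Nat.card_le_card_of_injective _ (lower_injective (n := n) hk)

open ColoredPartition in
theorem coloredPartitions_succ_lt {k n : ℕ} (hk : 4 ≤ k) (hn : 1 ≤ n) :
    coloredPartitions k (n + 1) < k * coloredPartitions k n := by
  have hk3 : 3 ≤ k := by omega
  refine (coloredPartitions_succ_le hk3 n).lt_of_ne fun h => lower_not_surjective hk hn ?_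
  have := ColoredPartition.finite hk3 n
  have := ColoredPartition.finite hk3 (n + 1)
  exact ((Nat.bijective_iff_injective_and_card _).2
    ⟨lower_injective hk3, by simpa [coloredPartitions] using h⟩).2

open ColoredPartition in
theorem coloredPartitions_one {k : ℕ} (hk : 3 ≤ k) : coloredPartitions k 1 = k := by
  apply le_antisymm
  · have h0 : coloredPartitions k 0 ≤ 1 := Finite.card_le_one_iff_subsingleton.2 inferInstance
    nlinarith [coloredPartitions_succ_le hk 0]
  · have := ColoredPartition.finite hk 1
    have hinj : Function.Injective (ones (k := k) 1) := fun c d h => by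
      have := congrArg ColoredPartition.parts h
      simpa [ones, Fin.ext_iff] using this
    simpa [coloredPartitions] using Nat.card_le_card_of_injective _ hinj

theorem coloredPartitions_lt_pow {k n : ℕ} (hk : 4 ≤ k) (hn : 2 ≤ n) :
    coloredPartitions k n < k ^ n := by
  induction n, hn using Nat.le_induction with
  | base =>
    have := coloredPartitions_succ_lt hk le_rfl
    rwa [coloredPartitions_one (by omega), ← sq] at this
  | succ n hn ih =>
    calc coloredPartitions k (n + 1) < k * coloredPartitions k n :=
          coloredPartitions_succ_lt hk (by omega)
      _ ≤ k * k ^ n := Nat.mul_le_mul_left k ih.le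
      _ = k ^ (n + 1) := (pow_succ' k n).symm

theorem prod_coloredPartitions_le {k : ℕ} (hk : 4 ≤ k) (s : Multiset ℕ) (hs : ∀ i ∈ s, 0 < i) :
    (s.map (coloredPartitions k)).prod ≤ k ^ s.sum ∧
      ((s.map (coloredPartitions k)).prod = k ^ s.sum → ∀ i ∈ s, i = 1) := by
  induction s using Multiset.induction_on with
  | empty => simp
  | cons a s ih =>
    obtain ⟨hle, heq⟩ := ih fun i hi => hs i (Multiset.mem_cons_of_mem hi)
    have ha : 0 < a := hs a (Multiset.mem_cons_self a s)
    rw [Multiset.map_cons, Multiset.prod_cons, Multiset.sum_cons, pow_add]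
    obtain rfl | ha : a = 1 ∨ 2 ≤ a := by omega
    · rw [coloredPartitions_one (by omega), pow_one]
      refine ⟨Nat.mul_le_mul_left k hle, fun h => ?_⟩
      simpa using heq (Nat.eq_of_mul_eq_mul_left (by omega) h)
    · have hlt := Nat.mul_lt_mul_of_lt_of_le (coloredPartitions_lt_pow hk ha) hle
        (pow_pos (by omega : 0 < k) _)
      exact ⟨hlt.le, fun h => absurd h hlt.ne⟩

theorem max_k_colored (k n : ℕ) (hk : 4 ≤ k) (hn : 1 ≤ n) :
    ∀ lam : Nat.Partition n,
      (lam.parts.map (coloredPartitions k)).prod ≤ k ^ n ∧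
      ((lam.parts.map (coloredPartitions k)).prod = k ^ n ↔
        lam.parts = Multiset.replicate n 1) := by
  intro lam
  obtain ⟨hle, heq⟩ := prod_coloredPartitions_le hk lam.parts fun i hi => lam.parts_pos hi
  rw [lam.parts_sum] at hle heq
  refine ⟨hle, fun h => ?_, fun h => ?_⟩
  · have hrep := Multiset.eq_replicate_card.2 (heq h)
    have hsum := lam.parts_sum
    rw [hrep, Multiset.sum_replicate, smul_eq_mul, mul_one] at hsum
    rwa [hsum] at hrep
  · rw [h, Multiset.map_replicate, Multiset.prod_replicate, coloredPartitions_one (by omega)]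
end
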